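/- Let A ∈ ℝ^{n×d}, S ∈ ℝ^{m×n}, R ∈ ℝ^{d×m'}, 0 < ε ≤ 1/4, and an integer t ≥ 1. Suppose: (i) SA is an (ε,t)-column-PCP of A; (ii) SAR is an (ε,t)-row-PCP of SA; (iii) ‖SA‖_F² ≥ (1−ε)‖A‖_F² and ‖SAR‖_F² ≥ (1−ε)‖SA‖_F²; and (iv) U ∈ ℝ^{m×t} has orthonormal columns and satisfies ‖(I_m − UUᵀ)·SAR‖_F ≤ (1+ε)·‖SAR − B₀‖_F for every B₀ ∈ ℝ^{m×m'} with rank(B₀) ≤ t. Then for every B ∈ ℝ^{n×d} with rank(B) ≤ t, ‖UᵀSA‖_F² ≥ ‖A‖_F² − ‖A − B‖_F² − 13ε‖A‖_F². -/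

import Mathlib

open Matrix BigOperators

/-- Squared Frobenius norm of a real matrix. -/
noncomputable def frobSq {m p : Type*} [Fintype m] [Fintype p]
    (M : Matrix m p ℝ) : ℝ :=
  ∑ i, ∑ j, (M i j) ^ 2

/-- `M'` is an `(ε,t)`-column projection-cost preserving sketch of `M`. -/
def IsColPCP {n m d : ℕ} (ε : ℝ) (t : ℕ)
    (M : Matrix (Fin n) (Fin d) ℝ) (M' : Matrix (Fin m) (Fin d) ℝ) : Prop :=
  ∀ P : Matrix (Fin d) (Fin d) ℝ, Pᵀ = P → P * P = P → P.rank ≤ t →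
    (1 - ε) * frobSq (M * (1 - P)) ≤ frobSq (M' * (1 - P)) ∧
    frobSq (M' * (1 - P)) ≤ (1 + ε) * frobSq (M * (1 - P))

/-- `M''` is an `(ε,t)`-row projection-cost preserving sketch of `M`. -/
def IsRowPCP {m d d' : ℕ} (ε : ℝ) (t : ℕ)
    (M : Matrix (Fin m) (Fin d) ℝ) (M'' : Matrix (Fin m) (Fin d') ℝ) : Prop :=
  ∀ Q : Matrix (Fin m) (Fin m) ℝ, Qᵀ = Q → Q * Q = Q → Q.rank ≤ t →
    (1 - ε) * frobSq ((1 - Q) * M) ≤ frobSq ((1 - Q) * M'') ∧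
    frobSq ((1 - Q) * M'') ≤ (1 + ε) * frobSq ((1 - Q) * M)

/-- The squared Frobenius norm is the trace of the Gram matrix. -/
lemma frobSq_eq_trace {m p : Type*} [Fintype m] [Fintype p] (M : Matrix m p ℝ) :
    frobSq M = (Mᵀ * M).trace := by
  rw [frobSq, Finset.sum_comm]
  simp [Matrix.trace, Matrix.mul_apply, pow_two]

lemma frobSq_nonneg {m p : Type*} [Fintype m] [Fintype p] (M : Matrix m p ℝ) :
    0 ≤ frobSq M := by
  unfold frobSq
  positivity

lemma frobSq_transpose {m p : Type*} [Fintype m] [Fintype p] (M : Matrix m p ℝ) :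
    frobSq Mᵀ = frobSq M := by
  simp only [frobSq, Matrix.transpose_apply]
  exact Finset.sum_comm

/-- Pythagoras for an orthogonal projection acting on the left. -/
lemma frobSq_eq_add_of_proj {m p : Type*} [Fintype m] [DecidableEq m] [Fintype p]
    {Q : Matrix m m ℝ} (hQ : Qᵀ = Q) (hQQ : Q * Q = Q) (X : Matrix m p ℝ) :
    frobSq X = frobSq (Q * X) + frobSq ((1 - Q) * X) := by
  have h₁ : (Q * X)ᵀ * (Q * X) = Xᵀ * Q * X := by
    rw [Matrix.transpose_mul, hQ, Matrix.mul_assoc, ← Matrix.mul_assoc Q Q, hQQ, Matrix.mul_assoc]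
  have h₂ : ((1 - Q) * X)ᵀ * ((1 - Q) * X) = Xᵀ * X - Xᵀ * Q * X := by
    have h : (1 - Q) * (1 - Q) = 1 - Q := by
      simp [Matrix.sub_mul, Matrix.mul_sub, hQQ]
    rw [Matrix.transpose_mul, Matrix.transpose_sub, hQ, Matrix.transpose_one, Matrix.mul_assoc,
      ← Matrix.mul_assoc (1 - Q) (1 - Q), h, Matrix.sub_mul, Matrix.mul_sub, Matrix.one_mul,
      Matrix.mul_assoc]
  rw [frobSq_eq_trace, frobSq_eq_trace, frobSq_eq_trace, h₁, h₂, Matrix.trace_sub]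
  ring

/-- The residual of projecting onto a space containing the columns of `C` is at most `X - C`. -/
lemma frobSq_residual_le {m p : Type*} [Fintype m] [DecidableEq m] [Fintype p]
    {Q : Matrix m m ℝ} (hQ : Qᵀ = Q) (hQQ : Q * Q = Q) (X C : Matrix m p ℝ) (hC : Q * C = C) :
    frobSq ((1 - Q) * X) ≤ frobSq (X - C) := by
  have h : (1 - Q) * (X - C) = (1 - Q) * X := by
    simp [Matrix.sub_mul, Matrix.mul_sub, hC]
  rw [frobSq_eq_add_of_proj hQ hQQ (X - C), h]
  linarith [frobSq_nonneg (Q * (X - C))]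

/-- The orthogonal projection onto the column space of `C`. -/
lemma exists_colSpace_proj {m p : Type*} [Fintype m] [DecidableEq m] [Fintype p] [DecidableEq p]
    (C : Matrix m p ℝ) :
    ∃ Q : Matrix m m ℝ, Qᵀ = Q ∧ Q * Q = Q ∧ Q * C = C ∧ Q.rank ≤ C.rank := by
  let K : Submodule ℝ (EuclideanSpace ℝ m) := LinearMap.range (Matrix.toEuclideanLin C)
  let e := Matrix.toEuclideanCLM (n := m) (𝕜 := ℝ)
  obtain ⟨Q, hQ⟩ : ∃ Q, e Q = K.starProjection :=
    EquivLike.surjective e _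
  have hmem (v : m → ℝ) : ∃ w : p → ℝ, Q *ᵥ v = C *ᵥ w := by
    have h : K.starProjection (WithLp.toLp 2 v) ∈ K := K.starProjection_apply_mem _
    rw [← hQ] at h
    obtain ⟨w, hw⟩ := h
    exact ⟨w.ofLp, (congrArg WithLp.ofLp hw).symm⟩
  refine ⟨Q, ?_, ?_, ?_, ?_⟩
  · have h : star Q = Q := by
      apply EquivLike.injective e
      rw [map_star, hQ]
      exact isSelfAdjoint_starProjection K
    simpa [Matrix.star_eq_conjTranspose] using h
  · apply EquivLike.injective e
    rw [map_mul, hQ]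
    exact K.isIdempotentElem_starProjection
  · apply Matrix.ext_of_mulVec_single
    intro i
    rw [← Matrix.mulVec_mulVec]
    have h : K.starProjection (WithLp.toLp 2 (C *ᵥ Pi.single i 1))
        = WithLp.toLp 2 (C *ᵥ Pi.single i 1) :=
      Submodule.starProjection_eq_self_iff.2 ⟨WithLp.toLp 2 (Pi.single i 1), rfl⟩
    rw [← hQ] at h
    exact congrArg WithLp.ofLp h
  · apply Submodule.finrank_mono
    rintro _ ⟨v, rfl⟩
    obtain ⟨w, hw⟩ := hmem v
    exact ⟨w, hw.symm⟩

/-- The orthogonal projection onto the row space of `C`. -/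
lemma exists_rowSpace_proj {m p : Type*} [Fintype m] [DecidableEq m] [Fintype p] [DecidableEq p]
    (C : Matrix m p ℝ) :
    ∃ P : Matrix p p ℝ, Pᵀ = P ∧ P * P = P ∧ C * P = C ∧ P.rank ≤ C.rank := by
  obtain ⟨P, hP, hPP, hPC, hr⟩ := exists_colSpace_proj Cᵀ
  refine ⟨P, hP, hPP, ?_, by rwa [Matrix.rank_transpose] at hr⟩
  simpa [hP] using congrArg Matrix.transpose hPC

/-- Under the PCP hypotheses, the Frobenius mass lower
bounds `‖SA‖_F² ≥ (1−ε)‖A‖_F²` and `‖SAR‖_F² ≥ (1−ε)‖SA‖_F²`, and the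
near-optimality of `U`, we have for every `B` of rank at most `t`:
`‖UᵀSA‖_F² ≥ ‖A‖_F² − ‖A − B‖_F² − 13ε‖A‖_F²`. -/
theorem pcp_sketch_mass_lower_bound
    {n d m m' : ℕ} (t : ℕ) (ht : 1 ≤ t) (ε : ℝ) (hε : 0 < ε ∧ ε ≤ 1 / 4)
    (A : Matrix (Fin n) (Fin d) ℝ) (S : Matrix (Fin m) (Fin n) ℝ)
    (R : Matrix (Fin d) (Fin m') ℝ) (U : Matrix (Fin m) (Fin t) ℝ)
    (hSA : IsColPCP ε t A (S * A))
    (hSAR : IsRowPCP ε t (S * A) (S * A * R))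
    (hmass₁ : (1 - ε) * frobSq A ≤ frobSq (S * A))
    (hmass₂ : (1 - ε) * frobSq (S * A) ≤ frobSq (S * A * R))
    (hUorth : Uᵀ * U = 1)
    (hUgood : ∀ B₀ : Matrix (Fin m) (Fin m') ℝ, B₀.rank ≤ t →
      Real.sqrt (frobSq ((1 - U * Uᵀ) * (S * A * R)))
        ≤ (1 + ε) * Real.sqrt (frobSq (S * A * R - B₀))) :
    ∀ B : Matrix (Fin n) (Fin d) ℝ, B.rank ≤ t →
      frobSq A - frobSq (A - B) - 13 * ε * frobSq A
        ≤ frobSq (Uᵀ * (S * A)) := by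
  intro B hB
  obtain ⟨hε0, hε1⟩ := hε
  rcases le_total (frobSq A) (frobSq (A - B)) with hle | hle
  · have := frobSq_nonneg (Uᵀ * (S * A))
    have := mul_nonneg hε0.le (frobSq_nonneg A)
    linarith
  obtain ⟨P, hP, hPP, hBP, hPr⟩ := exists_rowSpace_proj B
  obtain ⟨Q, hQ, hQQ, hQC, hQr⟩ := exists_colSpace_proj (S * A * P)
  have hPt : P.rank ≤ t := hPr.trans hB
  have hQt : Q.rank ≤ t := (hQr.trans (Matrix.rank_mul_le_right _ _)).trans hPt
  have hWT : (U * Uᵀ)ᵀ = U * Uᵀ := by simp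
  have hWW : U * Uᵀ * (U * Uᵀ) = U * Uᵀ := by
    rw [Matrix.mul_assoc, ← Matrix.mul_assoc Uᵀ, hUorth, Matrix.one_mul]
  have hWt : (U * Uᵀ).rank ≤ t :=
    (Matrix.rank_mul_le_left _ _).trans (U.rank_le_width)
  have hUW : frobSq (U * Uᵀ * (S * A)) = frobSq (Uᵀ * (S * A)) := by
    rw [frobSq_eq_trace, frobSq_eq_trace, Matrix.mul_assoc U, Matrix.transpose_mul U,
      Matrix.mul_assoc, ← Matrix.mul_assoc Uᵀ U, hUorth, Matrix.one_mul]
  have hpyth := frobSq_eq_add_of_proj hWT hWW (S * A)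
  have hP_le : frobSq (A * (1 - P)) ≤ frobSq (A - B) := by
    have h := frobSq_residual_le hP hPP Aᵀ Bᵀ (by
      simpa [hP] using congrArg Matrix.transpose hBP)
    rw [← Matrix.transpose_sub, frobSq_transpose, ← frobSq_transpose] at h
    simpa [hP] using h
  have hQ_le : frobSq ((1 - Q) * (S * A)) ≤ frobSq (S * A * (1 - P)) := by
    simpa [Matrix.mul_sub] using frobSq_residual_le hQ hQQ (S * A) (S * A * P) hQC
  have hU_le : frobSq ((1 - U * Uᵀ) * (S * A * R))
      ≤ (1 + ε) ^ 2 * frobSq ((1 - Q) * (S * A * R)) := by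
    have h := hUgood (Q * (S * A * R)) ((Matrix.rank_mul_le_left _ _).trans hQt)
    have h2 := pow_le_pow_left₀ (Real.sqrt_nonneg _) h 2
    rw [mul_pow, Real.sq_sqrt (frobSq_nonneg _), Real.sq_sqrt (frobSq_nonneg _)] at h2
    rwa [Matrix.sub_mul 1 Q, Matrix.one_mul]
  have hW_le := (hSAR _ hWT hWW hWt).1
  have hQ_le' := (hSAR Q hQ hQQ hQt).2
  have hP_le' := (hSA P hP hPP hPt).2
  have hchain : (1 - ε) * frobSq ((1 - U * Uᵀ) * (S * A)) ≤ (1 + ε) ^ 4 * frobSq (A - B) :=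
    calc (1 - ε) * frobSq ((1 - U * Uᵀ) * (S * A))
        ≤ (1 + ε) ^ 2 * frobSq ((1 - Q) * (S * A * R)) := hW_le.trans hU_le
      _ ≤ (1 + ε) ^ 2 * ((1 + ε) * ((1 + ε) * frobSq (A - B))) := by
          gcongr
          refine hQ_le'.trans ?_
          gcongr
          refine hQ_le.trans (hP_le'.trans ?_)
          gcongr
      _ = (1 + ε) ^ 4 * frobSq (A - B) := by ring
  have hpoly : (1 + ε) ^ 4 ≤ (1 - ε) * (1 + 12 * ε) := by
    have h2 : ε ^ 2 ≤ ε * (1 / 4) := by nlinarith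
    have h3 : ε ^ 3 ≤ ε * (1 / 16) := by nlinarith
    have h4 : ε ^ 4 ≤ ε * (1 / 64) := by nlinarith
    nlinarith
  have hres : frobSq ((1 - U * Uᵀ) * (S * A)) ≤ (1 + 12 * ε) * frobSq (A - B) := by
    refine le_of_mul_le_mul_left (hchain.trans ?_) (by linarith : 0 < 1 - ε)
    rw [← mul_assoc]
    exact mul_le_mul_of_nonneg_right hpoly (frobSq_nonneg _)
  have := mul_le_mul_of_nonneg_left hle hε0.le
  rw [hUW] at hpyth
  linarith
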